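/- Let q be a prime power, and write n = 2m + δ with δ ∈ {0,1}. Let g ∈ GL(n,F_q) and suppose the characteristic polynomial of h := g·g^τ equals (X - 1)^n or (X + 1)^n. Then either q^m divides #{x ∈ GL(n,F_q) : x g xᵀ = g}, or q is odd, n = 2, and #{x ∈ GL(n,F_q) : x g xᵀ = g} > q^m. -/

import Mathlib

open Matrix Polynomial

/-- The inverse-transpose automorphism of `GL(n,F)`: `g ↦ (gᵀ)⁻¹`. -/
noncomputable def tau {n : ℕ} {F : Type} [Field F] (g : GL (Fin n) F) : GL (Fin n) F where
  val := (g⁻¹).val.transpose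
  inv := g.val.transpose
  val_inv := by
    rw [← Matrix.transpose_mul, ← Units.val_mul, mul_inv_cancel, Units.val_one,
      Matrix.transpose_one]
  inv_val := by
    rw [← Matrix.transpose_mul, ← Units.val_mul, inv_mul_cancel, Units.val_one,
      Matrix.transpose_one]

/-- The stabilizer of a matrix under the congruence action of `GL`. -/
def congruenceStabilizer {ι F : Type*} [Fintype ι] [DecidableEq ι] [Field F]
    (g : Matrix ι ι F) : Subgroup (GL ι F) where
  carrier := {x | x.val * g * x.valᵀ = g}
  one_mem' := by simp
  mul_mem' := by
    intro x y hx hy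
    simp only [Set.mem_ofPred_eq, Units.val_mul, Matrix.transpose_mul] at *
    calc x.val * y.val * g * (y.valᵀ * x.valᵀ)
        = x.val * (y.val * g * y.valᵀ) * x.valᵀ := by simp only [Matrix.mul_assoc]
      _ = g := by rw [hy, hx]
  inv_mem' := by
    intro x hx
    simp only [Set.mem_ofPred_eq] at *
    have h1 : (x⁻¹).val * x.val = 1 := x.inv_mul
    have h2 : x.valᵀ * ((x⁻¹).val)ᵀ = 1 := by
      rw [← Matrix.transpose_mul, h1, Matrix.transpose_one]
    calc (x⁻¹).val * g * ((x⁻¹).val)ᵀ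
        = (x⁻¹).val * (x.val * g * x.valᵀ) * ((x⁻¹).val)ᵀ := by rw [hx]
      _ = ((x⁻¹).val * x.val) * g * (x.valᵀ * ((x⁻¹).val)ᵀ) := by simp only [Matrix.mul_assoc]
      _ = g := by rw [h1, h2, Matrix.one_mul, Matrix.mul_one]

/-- The matrices which are unitriangular with respect to the degree function `d`. -/
def gradedUnipotent {ι : Type*} (F : Type*) [Fintype ι] [DecidableEq ι] [Field F] [Finite F]
    (d : ι → ℕ) : Subgroup (GL ι F) :=
  let M : Submonoid (GL ι F) :=
    { carrier := {x | ∀ i j, d i ≤ d j → x.val i j = (1 : Matrix ι ι F) i j}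
      one_mem' := by simp
      mul_mem' := by
        intro x y hx hy i j hij
        rw [Units.val_mul, ← Matrix.one_mul (1 : Matrix ι ι F), Matrix.mul_apply, Matrix.mul_apply]
        refine Finset.sum_congr rfl fun k _ => ?_
        by_cases hk : d k < d i
        · have hkj : k ≠ j := by rintro rfl; omega
          rw [hy k j (by omega), Matrix.one_apply_ne hkj, mul_zero, mul_zero]
        · rw [hx i k (by omega)]
          by_cases hik : i = k
          · subst hik; rw [hy i j hij]
          · rw [Matrix.one_apply_ne hik, zero_mul, zero_mul] }
  { M with
    inv_mem' := by
      intro x hx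
      have : x⁻¹ = x ^ (orderOf x - 1) := by
        rw [inv_eq_iff_mul_eq_one, ← pow_succ',
          Nat.sub_add_cancel (orderOf_pos x), pow_orderOf_eq_one]
      rw [this]
      exact M.pow_mem hx _ }

section Counting

variable {ι F : Type*} [Fintype ι] [DecidableEq ι] [Field F]

lemma mem_gradedUnipotent [Finite F] {d : ι → ℕ} {x : GL ι F} :
    x ∈ gradedUnipotent F d ↔ ∀ i j, d i ≤ d j → x.val i j = (1 : Matrix ι ι F) i j := Iff.rfl

lemma isNilpotent_of_graded (d : ι → ℕ) (N : Matrix ι ι F)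
    (hN : ∀ i j, d i ≤ d j → N i j = 0) : IsNilpotent N := by
  have key : ∀ k i j, d i < d j + k → (N ^ k) i j = 0 := by
    intro k
    induction k with
    | zero =>
      intro i j h
      rw [pow_zero, Matrix.one_apply_ne]
      rintro rfl
      omega
    | succ k ih =>
      intro i j h
      rw [pow_succ, Matrix.mul_apply]
      refine Finset.sum_eq_zero fun l _ => ?_
      by_cases hl : d l ≤ d j
      · rw [hN l j hl, mul_zero]
      · rw [ih i l (by omega), zero_mul]
  refine ⟨Finset.univ.sup d + 1, ?_⟩
  ext i j
  have := Finset.le_sup (f := d) (Finset.mem_univ i)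
  exact key _ i j (by omega)

lemma card_gradedUnipotent [Fintype F] (d : ι → ℕ) :
    Nat.card (gradedUnipotent F d) =
      Fintype.card F ^ Fintype.card {p : ι × ι // d p.2 < d p.1} := by
  classical
  rw [← Fintype.card_fun, ← Nat.card_eq_fintype_card]
  refine Nat.card_congr (Equiv.ofBijective
    (fun x p => (x : GL ι F).val p.1.1 p.1.2) ⟨?_, ?_⟩)
  · intro x y hxy
    apply Subtype.ext
    apply Units.ext
    ext i j
    by_cases h : d j < d i
    · exact congrFun hxy ⟨(i, j), h⟩
    · rw [mem_gradedUnipotent.1 x.2 i j (by omega), mem_gradedUnipotent.1 y.2 i j (by omega)]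
  · intro f
    let N : Matrix ι ι F := fun i j => if h : d j < d i then f ⟨(i, j), h⟩ else 0
    have hN : ∀ i j, d i ≤ d j → N i j = 0 := fun i j h => dif_neg (by omega)
    obtain ⟨u, hu⟩ := (isNilpotent_of_graded d N hN).isUnit_one_add
    refine ⟨⟨u, ?_⟩, ?_⟩
    · intro i j h
      rw [hu, Matrix.add_apply, hN i j h, add_zero]
    · funext p
      obtain ⟨⟨i, j⟩, h⟩ := p
      have hij : i ≠ j := by rintro rfl; exact lt_irrefl _ h
      change u.val i j = _
      rw [hu, Matrix.add_apply, Matrix.one_apply_ne hij, zero_add]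
      exact dif_pos h

/-- `g` is concentrated in degrees `≥ c`, and its component of degree `c` is `ε`-symmetric. -/
structure IsAdapted (d : ι → ℕ) (c : ℕ) (ε : F) (g : Matrix ι ι F) : Prop where
  zero_of_lt : ∀ i j, d i + d j < c → g i j = 0
  symm_of_eq : ∀ i j, d i + d j = c → g i j = ε * g j i

namespace IsAdapted

variable {d : ι → ℕ} {c : ℕ} {ε : F} {g : Matrix ι ι F}

lemma exists_of_mem_gradedUnipotent [Finite F] (hg : IsAdapted d c ε g)
    {x : GL ι F} (hx : x ∈ gradedUnipotent F d) :
    ∃ A : Matrix ι ι F, (∀ i j, d i + d j ≤ c → (x.val * g * x.valᵀ) i j = g i j) ∧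
      ∀ i j, d i + d j = c + 1 → (x.val * g * x.valᵀ) i j = g i j + (A i j + ε * A j i) := by
  obtain ⟨N, hN⟩ : ∃ N, x.val = 1 + N := ⟨x.val - 1, by abel⟩
  have hN0 : ∀ i j, d i ≤ d j → N i j = 0 := by
    intro i j h
    have := mem_gradedUnipotent.1 hx i j h
    rwa [hN, Matrix.add_apply, add_eq_left] at this
  have hexp : x.val * g * x.valᵀ = g + (g * Nᵀ + N * g + N * g * Nᵀ) := by
    rw [hN, Matrix.transpose_add, Matrix.transpose_one]
    noncomm_ring
  have h1 : ∀ i j, d i + d j ≤ c → (N * g) i j = 0 := by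
    intro i j h
    rw [Matrix.mul_apply]
    refine Finset.sum_eq_zero fun k _ => ?_
    by_cases hk : d i ≤ d k
    · rw [hN0 i k hk, zero_mul]
    · rw [hg.zero_of_lt k j (by omega), mul_zero]
  have h2 : ∀ i j, d i + d j ≤ c → (g * Nᵀ) i j = 0 := by
    intro i j h
    rw [Matrix.mul_apply]
    refine Finset.sum_eq_zero fun k _ => ?_
    rw [Matrix.transpose_apply]
    by_cases hk : d j ≤ d k
    · rw [hN0 j k hk, mul_zero]
    · rw [hg.zero_of_lt i k (by omega), zero_mul]
  have h3 : ∀ i j, d i + d j ≤ c + 1 → (N * g * Nᵀ) i j = 0 := by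
    intro i j h
    rw [Matrix.mul_apply]
    refine Finset.sum_eq_zero fun k _ => ?_
    rw [Matrix.transpose_apply]
    by_cases hk : d j ≤ d k
    · rw [hN0 j k hk, mul_zero]
    · rw [h1 i k (by omega), zero_mul]
  have h4 : ∀ i j, d i + d j = c + 1 → (N * g) i j = ε * (g * Nᵀ) j i := by
    intro i j h
    rw [Matrix.mul_apply, Matrix.mul_apply, Finset.mul_sum]
    refine Finset.sum_congr rfl fun k _ => ?_
    rw [Matrix.transpose_apply]
    by_cases hk : d i ≤ d k
    · rw [hN0 i k hk, zero_mul, mul_zero, mul_zero]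
    · rcases Nat.lt_or_ge (d k + d j) c with h' | h'
      · rw [hg.zero_of_lt k j h', hg.zero_of_lt j k (by omega), zero_mul, mul_zero, mul_zero]
      · rw [hg.symm_of_eq k j (by omega)]
        ring
  refine ⟨g * Nᵀ, fun i j h => ?_, fun i j h => ?_⟩
  · simp only [hexp, Matrix.add_apply, h1 i j h, h2 i j h, h3 i j (by omega), add_zero]
  · simp only [hexp, Matrix.add_apply, h3 i j (by omega), h4 i j h, add_zero]

lemma card_quotient_le [LinearOrder ι] [Fintype F] (hg : IsAdapted d c ε g) (hε : ε * ε = 1)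
    (hdiag : ∀ i, d i + d i = c + 1 → 1 + ε = 0) :
    Nat.card (gradedUnipotent F d ⧸
        (congruenceStabilizer g).subgroupOf (gradedUnipotent F d)) ≤
      Fintype.card F ^ Fintype.card
        {p : ι × ι // c < d p.1 + d p.2 ∧ ¬ (d p.1 + d p.2 = c + 1 ∧ p.1 ≤ p.2)} := by
  classical
  rw [← Fintype.card_fun, ← Nat.card_eq_fintype_card]
  refine Nat.card_le_card_of_injective
    (fun a p => (a.out.val.val * g * a.out.val.valᵀ) p.1.1 p.1.2) ?_
  intro a b hab
  have hall : ∀ i j, c < d i + d j → ¬ (d i + d j = c + 1 ∧ i ≤ j) →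
      (a.out.val.val * g * a.out.val.valᵀ) i j = (b.out.val.val * g * b.out.val.valᵀ) i j :=
    fun i j h h' => congrFun hab ⟨(i, j), h, h'⟩
  obtain ⟨A, hA, hA'⟩ := hg.exists_of_mem_gradedUnipotent a.out.2
  obtain ⟨B, hB, hB'⟩ := hg.exists_of_mem_gradedUnipotent b.out.2
  have heq : a.out.val.val * g * a.out.val.valᵀ = b.out.val.val * g * b.out.val.valᵀ := by
    ext i j
    rcases Nat.lt_or_ge c (d i + d j) with h | h
    · by_cases h' : d i + d j = c + 1 ∧ i ≤ j
      · obtain ⟨h', hij⟩ := h'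
        rw [hA' i j h', hB' i j h']
        rcases hij.eq_or_lt with rfl | hij
        · linear_combination (A i i - B i i) * hdiag i h'
        · have := hall j i (by omega) (fun h'' => absurd h''.2 (not_le.2 hij))
          rw [hA' j i (by omega), hB' j i (by omega)] at this
          linear_combination ε * this - (A i j - B i j) * hε
      · exact hall i j h h'
    · rw [hA i j h, hB i j h]
  rw [← QuotientGroup.out_eq' a, ← QuotientGroup.out_eq' b, QuotientGroup.eq,
    Subgroup.mem_subgroupOf]
  have hinv : a.out.val⁻¹.val * a.out.val.val = 1 := a.out.val.inv_mul
  have hinv' : a.out.val.valᵀ * (a.out.val⁻¹.val)ᵀ = 1 := by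
    rw [← Matrix.transpose_mul, hinv, Matrix.transpose_one]
  change (a.out.val⁻¹.val * b.out.val.val) * g * (a.out.val⁻¹.val * b.out.val.val)ᵀ = g
  calc (a.out.val⁻¹.val * b.out.val.val) * g * (a.out.val⁻¹.val * b.out.val.val)ᵀ
      = a.out.val⁻¹.val * (b.out.val.val * g * b.out.val.valᵀ) * (a.out.val⁻¹.val)ᵀ := by
        simp only [Matrix.transpose_mul, Matrix.mul_assoc]
    _ = (a.out.val⁻¹.val * a.out.val.val) * g * (a.out.val.valᵀ * (a.out.val⁻¹.val)ᵀ) := by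
        rw [← heq]; simp only [Matrix.mul_assoc]
    _ = g := by rw [hinv, hinv', Matrix.one_mul, Matrix.mul_one]

lemma pow_dvd_card_congruenceStabilizer [LinearOrder ι] [Fintype F] (hg : IsAdapted d c ε g)
    (hε : ε * ε = 1) (hdiag : ∀ i, d i + d i = c + 1 → 1 + ε = 0)
    (σ : Equiv.Perm ι) (hσ : ∀ i, d i + d (σ i) = c) {m : ℕ} (f : Fin m → ι × ι)
    (hf : Function.Injective f)
    (hf' : ∀ k, d (f k).1 + d (f k).2 = c + 1 ∧ (f k).1 ≤ (f k).2) :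
    Fintype.card F ^ m ∣ Nat.card (congruenceStabilizer g) := by
  classical
  set q := Fintype.card F with hq
  set U := gradedUnipotent F d
  set S := congruenceStabilizer g
  set t := Fintype.card
        {p : ι × ι // c < d p.1 + d p.2 ∧ ¬ (d p.1 + d p.2 = c + 1 ∧ p.1 ≤ p.2)} with ht
  have hq0 : 0 < q := Fintype.card_pos
  have hcount : t + m ≤ Fintype.card {p : ι × ι // d p.2 < d p.1} := by
    have e1 : Fintype.card {p : ι × ι // d p.2 < d p.1} =
        Fintype.card {p : ι × ι // c < d p.1 + d p.2} := by
      refine Fintype.card_congr (Equiv.subtypeEquiv (Equiv.prodCongr (Equiv.refl ι) σ) ?_)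
      rintro ⟨i, j⟩
      have := hσ j
      simp only [Equiv.prodCongr_apply, Prod.map_apply, Equiv.refl_apply]
      omega
    rw [e1, ht, ← Fintype.card_fin m, ← Fintype.card_sum]
    refine Fintype.card_le_of_injective
      (Sum.elim (fun p => ⟨p.1, p.2.1⟩) (fun k => ⟨f k, by have := (hf' k).1; omega⟩)) ?_
    refine Function.Injective.sumElim ?_ ?_ ?_
    · intro p p' h
      exact Subtype.ext (Subtype.mk.inj h)
    · intro k k' h
      exact hf (congrArg Subtype.val h)
    · intro p k h
      have h' : p.1 = f k := congrArg Subtype.val h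
      exact p.2.2 (h' ▸ hf' k)
  have hU : Nat.card U = q ^ Fintype.card {p : ι × ι // d p.2 < d p.1} := card_gradedUnipotent d
  have hquot := hg.card_quotient_le hε hdiag
  have hmul := Subgroup.card_eq_card_quotient_mul_card_subgroup (S.subgroupOf U)
  obtain ⟨p, k, hp, -, hpk⟩ := (isPrimePow_nat_iff q).1 (FiniteField.isPrimePow_card F)
  have hdvd : Nat.card (S.subgroupOf U) ∣ Nat.card S :=
    Subgroup.card_dvd_of_injective
      ((U.subtype.comp (S.subgroupOf U).subtype).codRestrict S fun x => x.2)
      fun x y h => Subtype.ext (Subtype.ext (congrArg (fun z : S => z.val) h))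
  refine dvd_trans ?_ hdvd
  have h1 : Nat.card (S.subgroupOf U) ∣ p ^ (k * Fintype.card {p : ι × ι // d p.2 < d p.1}) := by
    rw [pow_mul, hpk, ← hU, hmul]
    exact dvd_mul_left _ _
  obtain ⟨a, -, ha⟩ := (Nat.dvd_prime_pow hp).1 h1
  have h2 : q ^ (t + m) ≤ q ^ t * Nat.card (S.subgroupOf U) :=
    calc q ^ (t + m) ≤ Nat.card U := hU ▸ Nat.pow_le_pow_right hq0 hcount
      _ ≤ _ := by rw [hmul]; exact Nat.mul_le_mul_right _ hquot
  rw [pow_add] at h2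
  have h3 := Nat.le_of_mul_le_mul_left h2 (pow_pos hq0 t)
  rw [ha, ← hpk, ← pow_mul] at h3 ⊢
  exact pow_dvd_pow p ((Nat.pow_le_pow_iff_right hp.one_lt).1 h3)

end IsAdapted

end Counting

section BilinearForms

variable {F V : Type*} [Field F] [AddCommGroup V] [Module F V]

/-- `B` is a nondegenerate bilinear form with asymmetry `h`, and `h` has `ε` as only eigenvalue. -/
structure IsAsymmetry (B : V →ₗ[F] V →ₗ[F] F) (h : Module.End F V) (ε : F) : Prop where
  apply_eq : ∀ u v, B u v = B v (h u)
  isNilpotent : IsNilpotent (h - ε • 1)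
  nondegenerate : ∀ u, (∀ v, B u v = 0) → u = 0

namespace IsAsymmetry

variable {B : V →ₗ[F] V →ₗ[F] F} {h : Module.End F V} {ε : F}

lemma apply_eq_of_eigenvector (hB : IsAsymmetry B h ε) {x : V} (hx : h x = ε • x) (y : V) :
    B x y = ε * B y x := by
  rw [hB.apply_eq, hx, map_smul, smul_eq_mul]

lemma exists_isotropic_or_forall (hB : IsAsymmetry B h ε) (hε : ε * ε = 1) :
    (∃ x ≠ 0, h x = ε • x ∧ B x x = 0) ∨ ∀ u, h u = ε • u := by
  classical
  set k := h - ε • (1 : Module.End F V) with hk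
  have hkapp : ∀ u, k u = h u - ε • u := fun u => by simp [hk]
  by_cases h0 : k = 0
  · right
    intro u
    rw [← sub_eq_zero, ← hkapp, h0, LinearMap.zero_apply]
  left
  have hnil : ∃ r, k ^ r = 0 := hB.isNilpotent
  obtain ⟨r, hr⟩ : ∃ r, Nat.find hnil = r + 2 := by
    refine ⟨Nat.find hnil - 2, ?_⟩
    have h1 : Nat.find hnil ≠ 0 := fun h' => by
      have := Nat.find_spec hnil
      rw [h', pow_zero] at this
      exact h0 (by rw [← one_mul k, this, zero_mul])
    have h2 : Nat.find hnil ≠ 1 := fun h' => by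
      have := Nat.find_spec hnil
      rw [h', pow_one] at this
      exact h0 this
    omega
  have hz : k ^ (r + 2) = 0 := hr ▸ Nat.find_spec hnil
  have hnz : k ^ (r + 1) ≠ 0 := Nat.find_min hnil (by omega)
  obtain ⟨u, hu⟩ : ∃ u, (k ^ (r + 1)) u ≠ 0 := by
    by_contra! h'
    exact hnz (LinearMap.ext h')
  have hx : h ((k ^ (r + 1)) u) = ε • (k ^ (r + 1)) u := by
    rw [← sub_eq_zero, ← hkapp, ← Module.End.mul_apply, ← pow_succ', hz, LinearMap.zero_apply]
  refine ⟨(k ^ (r + 1)) u, hu, hx, ?_⟩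
  generalize hxx : (k ^ (r + 1)) u = x at hx ⊢
  have hxy : x = k ((k ^ r) u) := by rw [← hxx, pow_succ', Module.End.mul_apply]
  have : B x (k ((k ^ r) u)) = 0 := by
    rw [hkapp, map_sub, map_smul, smul_eq_mul, ← hB.apply_eq, hB.apply_eq_of_eigenvector hx]
    linear_combination (- B ((k ^ r) u) x) * hε
  rwa [← hxy] at this

lemma exists_eigenvector [Nontrivial V] (hB : IsAsymmetry B h ε) (hε : ε * ε = 1) :
    ∃ x ≠ 0, h x = ε • x := by
  rcases hB.exists_isotropic_or_forall hε with ⟨x, hx, hx', -⟩ | h'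
  · exact ⟨x, hx, hx'⟩
  · obtain ⟨x, hx⟩ := exists_ne (0 : V)
    exact ⟨x, hx, h' x⟩

end IsAsymmetry

lemma exists_isotropic_of_three_le_finrank [Finite F] [FiniteDimensional F V]
    (B : V →ₗ[F] V →ₗ[F] F) (hV : 3 ≤ Module.finrank F V) : ∃ x ≠ 0, B x x = 0 := by
  classical
  have := Fintype.ofFinite F
  obtain ⟨p, hp⟩ := CharP.exists F
  have hprime : p.Prime := CharP.char_is_prime F p
  let b := Module.finBasis F V
  let f : MvPolynomial (Fin (Module.finrank F V)) F :=
    ∑ i, ∑ j, MvPolynomial.C (B (b i) (b j)) * (MvPolynomial.X i * MvPolynomial.X j)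
  have hdeg : f.totalDegree < Fintype.card (Fin (Module.finrank F V)) := by
    rw [Fintype.card_fin]
    refine lt_of_le_of_lt (?_ : _ ≤ 2) hV
    refine MvPolynomial.totalDegree_finsetSum_le fun i _ =>
      MvPolynomial.totalDegree_finsetSum_le fun j _ => ?_
    refine (MvPolynomial.totalDegree_mul _ _).trans ?_
    rw [MvPolynomial.totalDegree_C, zero_add]
    refine (MvPolynomial.totalDegree_mul _ _).trans ?_
    rw [MvPolynomial.totalDegree_X, MvPolynomial.totalDegree_X]
  have heval : ∀ a : Fin (Module.finrank F V) → F,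
      MvPolynomial.eval a f = B (∑ i, a i • b i) (∑ i, a i • b i) := by
    intro a
    simp only [f, map_sum, map_mul, MvPolynomial.eval_C, MvPolynomial.eval_X, map_smul,
      LinearMap.sum_apply, LinearMap.smul_apply, smul_eq_mul, Finset.mul_sum]
    rw [Finset.sum_comm]
    refine Finset.sum_congr rfl fun i _ => Finset.sum_congr rfl fun j _ => ?_
    ring
  have hdvd := char_dvd_card_solutions p hdeg
  have hpos : 0 < Fintype.card {a // MvPolynomial.eval a f = 0} :=
    Fintype.card_pos_iff.2 ⟨⟨0, by rw [heval]; simp⟩⟩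
  obtain ⟨a, ha⟩ := Fintype.exists_ne_of_one_lt_card
    (lt_of_lt_of_le hprime.one_lt (Nat.le_of_dvd hpos hdvd)) ⟨0, by rw [heval]; simp⟩
  refine ⟨∑ i, a.1 i • b i, fun h0 => ha (Subtype.ext ?_), by rw [← heval]; exact a.2⟩
  funext i
  exact Fintype.linearIndependent_iff.1 b.linearIndependent a.1 h0 i

lemma exists_isotropic_of_skew [Finite F] [FiniteDimensional F V]
    (B : V →ₗ[F] V →ₗ[F] F) (hV : 2 ≤ Module.finrank F V) (hB : ∀ u v, B u v = - B v u) :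
    ∃ x ≠ 0, B x x = 0 := by
  classical
  let b := Module.finBasis F V
  set u := b ⟨0, by omega⟩ with hu
  set w := b ⟨1, by omega⟩ with hw
  by_cases hww : B w w = 0
  · exact ⟨w, b.ne_zero _, hww⟩
  have h2 : (2 : F) = 0 := by
    have : 2 * B w w = 0 := by linear_combination hB w w
    exact (mul_eq_zero.1 this).resolve_right hww
  have hchar : ringChar F = 2 := by
    have : CharP F 2 := CharTwo.of_one_ne_zero_of_two_eq_zero one_ne_zero h2
    exact ringChar.eq F 2
  obtain ⟨t, ht⟩ := FiniteField.isSquare_of_char_two hchar (B u u / B w w)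
  refine ⟨u + t • w, fun h0 => ?_, ?_⟩
  · have h1 := congrArg (fun z => b.repr z ⟨0, by omega⟩) h0
    simp [hu, hw] at h1
  · have h1 : B u u = t * t * B w w := by rw [← ht, div_mul_cancel₀ _ hww]
    simp only [map_add, map_smul, LinearMap.add_apply, LinearMap.smul_apply, smul_eq_mul]
    linear_combination h1 + t * hB u w + t ^ 2 * B w w * h2

namespace IsAsymmetry

variable {B : V →ₗ[F] V →ₗ[F] F} {h : Module.End F V} {ε : F}

lemma exists_reduction [FiniteDimensional F V] (hB : IsAsymmetry B h ε) (hε : ε * ε = 1)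
    {x : V} (hx0 : x ≠ 0) (hx : h x = ε • x) (hxx : B x x = 0) {n : ℕ}
    (hV : Module.finrank F V = n + 2) :
    ∃ (W : Submodule F V) (h' : Module.End F W) (w : V),
      IsAsymmetry (B.domRestrict₁₂ W W) h' ε ∧ Module.finrank F W = n ∧ (∀ u ∈ W, B x u = 0) ∧
      ∀ b : Fin n → W, LinearIndependent F b →
        LinearIndependent F
          (Fin.snoc (Fin.cons x fun i => (b i : V)) w : Fin (n + 2) → V) := by
  have hε0 : ε ≠ 0 := fun h' => by simp [h'] at hε
  obtain ⟨w, hw⟩ : ∃ w, B x w = 1 := by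
    obtain ⟨w, hw⟩ : ∃ w, B x w ≠ 0 := by
      by_contra! h'
      exact hx0 (hB.nondegenerate x h')
    exact ⟨(B x w)⁻¹ • w, by rw [map_smul, smul_eq_mul, inv_mul_cancel₀ hw]⟩
  have hwx : B w x = ε := by
    have := hB.apply_eq_of_eigenvector hx w
    linear_combination (- ε) * this + ε * hw - B w x * hε
  let W : Submodule F V := LinearMap.ker ((B x).prod (B w))
  have hW : ∀ u, u ∈ W ↔ B x u = 0 ∧ B w u = 0 := by
    intro u
    rw [LinearMap.mem_ker, LinearMap.prod_apply]
    exact Prod.mk_eq_zero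
  have hright : ∀ u, B x u = 0 → B u x = 0 := by
    intro u hu
    rw [hB.apply_eq_of_eigenvector hx] at hu
    exact (mul_eq_zero.1 hu).resolve_left hε0
  obtain ⟨P, hP⟩ : ∃ P : Module.End F V, ∀ u, P u = u - (ε * B w u) • x :=
    ⟨LinearMap.id - ε • (LinearMap.toSpanSingleton F V x ∘ₗ B w), fun u => by simp [smul_smul]⟩
  have hPW : ∀ u, B x u = 0 → P u ∈ W := by
    intro u hu
    rw [hW, hP]
    constructor
    · rw [map_sub, map_smul, hu, hxx, smul_zero, sub_zero]
    · rw [map_sub, map_smul, hwx, smul_eq_mul]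
      linear_combination (- B w u) * hε
  have hhx : ∀ u, B x u = 0 → B x (h u) = 0 := fun u hu => by
    rw [← hB.apply_eq, hright u hu]
  let h' : Module.End F W :=
    (P ∘ₗ h).restrict (p := W) (q := W) fun u hu => hPW _ (hhx u ((hW u).1 hu).1)
  have hh' : ∀ u : W, (h' u : V) = P (h u) := fun u => rfl
  have hPx : P x = 0 := by
    rw [hP, hwx, hε, one_smul, sub_self]
  refine ⟨W, h', w, ⟨?_, ?_, ?_⟩, ?_, fun u hu => ((hW u).1 hu).1, ?_⟩
  · intro u v
    rw [LinearMap.domRestrict₁₂_apply, LinearMap.domRestrict₁₂_apply, hh', hP, map_sub, map_smul,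
      hright v ((hW v).1 v.2).1, smul_zero, sub_zero, hB.apply_eq]
  · obtain ⟨r, hr⟩ := hB.isNilpotent
    refine ⟨r, ?_⟩
    have key : ∀ j (u : W), ((((h' - ε • (1 : Module.End F W)) ^ j) u : W) : V) =
        P (((h - ε • (1 : Module.End F V)) ^ j) u) := by
      intro j u
      induction j with
      | zero =>
        simp only [pow_zero, Module.End.one_apply]
        rw [hP, ((hW u).1 u.2).2, mul_zero, zero_smul, sub_zero]
      | succ j ih =>
        rw [pow_succ', pow_succ', Module.End.mul_apply, Module.End.mul_apply]
        generalize ((h' - ε • (1 : Module.End F W)) ^ j) u = y at ih ⊢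
        generalize ((h - ε • (1 : Module.End F V)) ^ j) (u : V) = z at ih ⊢
        rw [LinearMap.sub_apply, LinearMap.sub_apply, LinearMap.smul_apply, LinearMap.smul_apply,
          Module.End.one_apply, Module.End.one_apply, Submodule.coe_sub, Submodule.coe_smul, hh',
          map_sub, map_smul, ih]
        congr 1
        rw [hP z, map_sub, map_sub, map_smul, map_smul, hx, map_smul, hPx, smul_zero, smul_zero,
          sub_zero]
    ext u
    rw [key, hr]
    simp
  · intro u hu
    have hxu := (hW u).1 u.2
    have hux : (u : V) = B u w • x := by
      rw [← sub_eq_zero]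
      refine hB.nondegenerate _ fun v => ?_
      have hmem : v - (B x v) • w - (ε * (B w v - B x v * B w w)) • x ∈ W := by
        rw [hW]
        constructor
        · simp only [map_sub, map_smul, smul_eq_mul, hw, hxx]
          ring
        · simp only [map_sub, map_smul, smul_eq_mul, hwx]
          linear_combination (- (B w v - B x v * B w w)) * hε
      have h1 := hu ⟨_, hmem⟩
      rw [LinearMap.domRestrict₁₂_apply] at h1
      simp only [map_sub, map_smul, smul_eq_mul, hright _ hxu.1] at h1
      simp only [map_sub, map_smul, LinearMap.sub_apply, LinearMap.smul_apply, smul_eq_mul]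
      linear_combination h1
    have h2 := hxu.2
    rw [hux, map_smul, hwx, smul_eq_mul] at h2
    have h3 := (mul_eq_zero.1 h2).resolve_right hε0
    rw [h3, zero_smul] at hux
    exact Subtype.ext hux
  · have hsurj : LinearMap.range ((B x).prod (B w)) = ⊤ := by
      rw [LinearMap.range_eq_top]
      rintro ⟨a, c⟩
      refine ⟨a • w + (ε * (c - a * B w w)) • x, ?_⟩
      rw [LinearMap.prod_apply]
      refine Prod.ext ?_ ?_
      · simp [hw, hxx]
      · change B w _ = c
        simp only [map_add, map_smul, smul_eq_mul, hwx]
        linear_combination (c - a * B w w) * hε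
    have := LinearMap.finrank_range_add_finrank_ker ((B x).prod (B w))
    rw [hsurj, finrank_top, Module.finrank_prod, Module.finrank_self, hV] at this
    change Module.finrank F W = n
    change 1 + 1 + Module.finrank F W = n + 2 at this
    omega
  · intro b hb
    have hb' : LinearIndependent F fun i => (b i : V) :=
      hb.map' W.subtype (Submodule.ker_subtype W)
    have hspan : Submodule.span F (Set.range fun i => (b i : V)) ≤ W := by
      rw [Submodule.span_le]
      rintro _ ⟨i, rfl⟩
      exact (b i).2
    rw [linearIndependent_finSnoc, linearIndependent_finCons]
    refine ⟨⟨hb', fun hmem => ?_⟩, fun hmem => ?_⟩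
    · have := ((hW x).1 (hspan hmem)).2
      rw [hwx] at this
      exact hε0 this
    · have hle : Submodule.span F
          (Set.range (Fin.cons x fun i => (b i : V) : Fin (n + 1) → V)) ≤ LinearMap.ker (B x) := by
        rw [Submodule.span_le]
        rintro _ ⟨i, rfl⟩
        refine Fin.cases ?_ (fun i => ?_) i
        · simpa using hxx
        · simpa using ((hW _).1 (b i).2).1
      have := LinearMap.mem_ker.1 (hle hmem)
      rw [hw] at this
      exact one_ne_zero this

lemma isAdapted_snoc_cons (hB : IsAsymmetry B h ε) (hε : ε * ε = 1)
    {x : V} (hx : h x = ε • x) (hxx : B x x = 0) (w : V) {n : ℕ} {b : Fin n → V}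
    (hxb : ∀ i, B x (b i) = 0) {d : Fin n → ℕ} {c : ℕ}
    (hb : IsAdapted d c ε (Matrix.of fun i j => B (b i) (b j))) {d' : Fin (n + 2) → ℕ}
    {c' : ℕ} (h0 : c' ≤ d' (Fin.castSucc 0) + d' (Fin.last _))
    (hmid : ∀ i j : Fin n,
      d' (Fin.castSucc i.succ) + d' (Fin.castSucc j.succ) + c = d i + d j + c')
    (hmidlast : ∀ i : Fin n, c' < d' (Fin.castSucc i.succ) + d' (Fin.last _))
    (hlast : c' < d' (Fin.last _) + d' (Fin.last _)) :
    IsAdapted d' c' ε (Matrix.of fun i j =>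
      B ((Fin.snoc (Fin.cons x b) w : Fin (n + 2) → V) i)
        ((Fin.snoc (Fin.cons x b) w : Fin (n + 2) → V) j)) := by
  have hbx : ∀ i, B (b i) x = 0 := fun i => by
    have := hB.apply_eq_of_eigenvector hx (b i)
    linear_combination (- ε) * this + ε * hxb i - B (b i) x * hε
  constructor
  · intro i j hij
    rw [Matrix.of_apply]
    refine Fin.lastCases (fun hij => ?_) (fun i => Fin.cases (fun hij => ?_) (fun i hij => ?_) i)
      i hij
    · revert hij
      refine Fin.lastCases (fun hij => ?_)
        (fun j => Fin.cases (fun hij => ?_) (fun j hij => ?_) j) j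
      · omega
      · omega
      · have := hmidlast j
        omega
    · revert hij
      refine Fin.lastCases (fun hij => ?_)
        (fun j => Fin.cases (fun hij => ?_) (fun j hij => ?_) j) j
      · omega
      · simpa only [Fin.snoc_castSucc, Fin.cons_zero] using hxx
      · simpa only [Fin.snoc_castSucc, Fin.cons_zero, Fin.cons_succ] using hxb j
    · revert hij
      refine Fin.lastCases (fun hij => ?_)
        (fun j => Fin.cases (fun hij => ?_) (fun j hij => ?_) j) j
      · have := hmidlast i
        omega
      · simpa only [Fin.snoc_castSucc, Fin.cons_zero, Fin.cons_succ] using hbx i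
      · have := hmid i j
        simpa only [Fin.snoc_castSucc, Fin.cons_succ, Matrix.of_apply] using
          hb.zero_of_lt i j (by omega)
  · intro i j hij
    rw [Matrix.of_apply, Matrix.of_apply]
    have hxw := hB.apply_eq_of_eigenvector hx w
    refine Fin.lastCases (fun hij => ?_) (fun i => Fin.cases (fun hij => ?_) (fun i hij => ?_) i)
      i hij
    · revert hij
      refine Fin.lastCases (fun hij => ?_)
        (fun j => Fin.cases (fun hij => ?_) (fun j hij => ?_) j) j
      · omega
      · simp only [Fin.snoc_castSucc, Fin.cons_zero, Fin.snoc_last]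
        linear_combination (- ε) * hxw - B w x * hε
      · have := hmidlast j
        omega
    · revert hij
      refine Fin.lastCases (fun hij => ?_)
        (fun j => Fin.cases (fun hij => ?_) (fun j hij => ?_) j) j
      · simpa only [Fin.snoc_castSucc, Fin.cons_zero, Fin.snoc_last] using hxw
      · simp only [Fin.snoc_castSucc, Fin.cons_zero, hxx, mul_zero]
      · simp only [Fin.snoc_castSucc, Fin.cons_zero, Fin.cons_succ, hxb, hbx, mul_zero]
    · revert hij
      refine Fin.lastCases (fun hij => ?_)
        (fun j => Fin.cases (fun hij => ?_) (fun j hij => ?_) j) j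
      · have := hmidlast i
        omega
      · simp only [Fin.snoc_castSucc, Fin.cons_zero, Fin.cons_succ, hxb, hbx, mul_zero]
      · have := hmid i j
        simpa only [Fin.snoc_castSucc, Fin.cons_succ, Matrix.of_apply] using
          hb.symm_of_eq i j (by omega)

lemma exists_isAdapted_succ_succ [FiniteDimensional F V] (hB : IsAsymmetry B h ε)
    (hε : ε * ε = 1) {x : V} (hx0 : x ≠ 0) (hx : h x = ε • x) (hxx : B x x = 0) {n : ℕ}
    (hV : Module.finrank F V = n + 2) {d : Fin n → ℕ} {c : ℕ} {d' : Fin (n + 2) → ℕ}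
    {c' : ℕ} (h0 : c' ≤ d' (Fin.castSucc 0) + d' (Fin.last _))
    (hmid : ∀ i j : Fin n,
      d' (Fin.castSucc i.succ) + d' (Fin.castSucc j.succ) + c = d i + d j + c')
    (hmidlast : ∀ i : Fin n, c' < d' (Fin.castSucc i.succ) + d' (Fin.last _))
    (hlast : c' < d' (Fin.last _) + d' (Fin.last _))
    (ih : ∀ (W : Submodule F V) (B' : W →ₗ[F] W →ₗ[F] F) (h' : Module.End F W),
      IsAsymmetry B' h' ε → Module.finrank F W = n →
      ∃ b : Fin n → W, LinearIndependent F b ∧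
        IsAdapted d c ε (Matrix.of fun i j => B' (b i) (b j))) :
    ∃ b : Fin (n + 2) → V, LinearIndependent F b ∧
      IsAdapted d' c' ε (Matrix.of fun i j => B (b i) (b j)) := by
  obtain ⟨W, h', w, hB', hW, hxW, hli⟩ := hB.exists_reduction hε hx0 hx hxx hV
  obtain ⟨b, hb, hb'⟩ := ih W _ h' hB' hW
  exact ⟨_, hli b hb, hB.isAdapted_snoc_cons hε hx hxx w (fun i => hxW _ (b i).2) hb'
    h0 hmid hmidlast hlast⟩

end IsAsymmetry

lemma exists_isAdapted_of_odd_or [Finite F] {ε : F} (hε : ε * ε = 1) (n : ℕ) :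
    ∀ {V : Type*} [AddCommGroup V] [Module F V] [FiniteDimensional F V]
      (B : V →ₗ[F] V →ₗ[F] F) (h : Module.End F V), IsAsymmetry B h ε →
      Module.finrank F V = n → (n % 2 = 1 ∨ ε = -1) →
      ∃ b : Fin n → V, LinearIndependent F b ∧
        IsAdapted (fun i : Fin n => (i : ℕ)) (n - 1) ε (Matrix.of fun i j => B (b i) (b j)) := by
  induction n using Nat.twoStepInduction with
  | zero =>
    intro V _ _ _ B h hB hV _
    exact ⟨Fin.elim0, linearIndependent_empty_type, fun i => i.elim0, fun i => i.elim0⟩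
  | one =>
    intro V _ _ _ B h hB hV _
    have := Module.nontrivial_of_finrank_pos (R := F) (M := V) (by omega)
    obtain ⟨x, hx0, hx⟩ := hB.exists_eigenvector hε
    refine ⟨fun _ => x, LinearIndependent.of_subsingleton 0 hx0, fun i j hij => ?_, fun i j _ => ?_⟩
    · omega
    · exact hB.apply_eq_of_eigenvector hx x
  | more n ih _ =>
    intro V _ _ _ B h hB hV hn
    obtain ⟨x, hx0, hx, hxx⟩ : ∃ x ≠ 0, h x = ε • x ∧ B x x = 0 := by
      rcases hB.exists_isotropic_or_forall hε with h' | h'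
      · exact h'
      · obtain ⟨x, hx0, hxx⟩ : ∃ x ≠ 0, B x x = 0 := by
          by_cases h3 : 3 ≤ Module.finrank F V
          · exact exists_isotropic_of_three_le_finrank B h3
          · have hε1 : ε = -1 := hn.resolve_left (by omega)
            refine exists_isotropic_of_skew B (by omega) fun u v => ?_
            rw [hB.apply_eq_of_eigenvector (h' u), hε1, neg_one_mul]
        exact ⟨x, hx0, h' x, hxx⟩
    refine hB.exists_isAdapted_succ_succ hε hx0 hx hxx hV (d := fun i => i) (c := n - 1)
      ?_ ?_ ?_ ?_ fun W B' h' hB' hW => ih B' h' hB' hW ?_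
    · simp
    · intro i j
      simp only [Fin.val_castSucc, Fin.val_succ]
      omega
    · intro i
      simp only [Fin.val_castSucc, Fin.val_succ, Fin.val_last]
      omega
    · simp only [Fin.val_last]
      omega
    · exact hn.imp_left fun h' => by omega

lemma exists_isAdapted_of_even [Finite F] (k : ℕ) :
    ∀ {V : Type*} [AddCommGroup V] [Module F V] [FiniteDimensional F V]
      (B : V →ₗ[F] V →ₗ[F] F) (h : Module.End F V), IsAsymmetry B h 1 →
      Module.finrank F V = 2 * k + 2 →
      ∃ b : Fin (2 * k + 2) → V, LinearIndependent F b ∧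
        IsAdapted (fun i : Fin (2 * k + 2) => if (i : ℕ) < k + 1 then (i : ℕ) else i - 1) (2 * k) 1
          (Matrix.of fun i j => B (b i) (b j)) := by
  induction k with
  | zero =>
    intro V _ _ _ B h hB hV
    have := Module.nontrivial_of_finrank_pos (R := F) (M := V) (by omega)
    obtain ⟨x, hx0, hx⟩ := hB.exists_eigenvector (one_mul 1)
    obtain ⟨w, hw⟩ := exists_linearIndependent_pair_of_one_lt_finrank (R := F) (by omega) hx0
    have hxw := hB.apply_eq_of_eigenvector hx w
    refine ⟨![x, w], hw, fun i j hij => ?_, fun i j _ => ?_⟩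
    · omega
    · rw [one_mul] at hxw ⊢
      simp only [Matrix.of_apply]
      fin_cases i <;> fin_cases j <;> simp [hxw]
  | succ k ih =>
    intro V _ _ _ B h hB hV
    obtain ⟨x, hx0, hx, hxx⟩ : ∃ x ≠ 0, h x = (1 : F) • x ∧ B x x = 0 := by
      rcases hB.exists_isotropic_or_forall (one_mul 1) with h' | h'
      · exact h'
      · obtain ⟨x, hx0, hxx⟩ := exists_isotropic_of_three_le_finrank B (by omega)
        exact ⟨x, hx0, h' x, hxx⟩
    refine hB.exists_isAdapted_succ_succ (n := 2 * k + 2) (one_mul 1) hx0 hx hxx hV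
      (d := fun i : Fin (2 * k + 2) => if (i : ℕ) < k + 1 then (i : ℕ) else i - 1) (c := 2 * k)
      ?_ ?_ ?_ ?_ fun W B' h' hB' hW => ih B' h' hB' hW
    · change 2 * (k + 1) ≤ (if 0 < k + 1 + 1 then 0 else 0 - 1) +
        (if 2 * k + 2 + 1 < k + 1 + 1 then 2 * k + 2 + 1 else 2 * k + 2 + 1 - 1)
      split_ifs <;> omega
    · intro i j
      simp only [Fin.val_castSucc, Fin.val_succ]
      split_ifs <;> omega
    · intro i
      simp only [Fin.val_castSucc, Fin.val_succ, Fin.val_last]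
      split_ifs <;> omega
    · simp only [Fin.val_last]
      split_ifs <;> omega

end BilinearForms

section Matrices

variable {ι F : Type*} [Fintype ι] [DecidableEq ι] [Field F]

lemma card_congruenceStabilizer_congr (g : Matrix ι ι F) (y : GL ι F) :
    Nat.card (congruenceStabilizer (y.val * g * y.valᵀ)) = Nat.card (congruenceStabilizer g) := by
  have hy : y⁻¹.val * y.val = 1 := y.inv_mul
  have hyT : y.valᵀ * y⁻¹.valᵀ = 1 := by rw [← Matrix.transpose_mul, hy, Matrix.transpose_one]
  refine (Nat.card_congr (Equiv.subtypeEquiv (MulAut.conj y).toEquiv fun x => ?_)).symm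
  change x.val * g * x.valᵀ = g ↔ (y.val * x.val * y⁻¹.val) * (y.val * g * y.valᵀ) *
    (y.val * x.val * y⁻¹.val)ᵀ = y.val * g * y.valᵀ
  have key : (y.val * x.val * y⁻¹.val) * (y.val * g * y.valᵀ) * (y.val * x.val * y⁻¹.val)ᵀ =
      y.val * (x.val * g * x.valᵀ) * y.valᵀ :=
    calc _ = y.val * x.val * (y⁻¹.val * y.val) * g * (y.valᵀ * y⁻¹.valᵀ) * x.valᵀ * y.valᵀ := by
          simp only [Matrix.transpose_mul, Matrix.mul_assoc]
      _ = _ := by rw [hy, hyT]; simp only [Matrix.mul_assoc, Matrix.mul_one]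
  rw [key]
  refine ⟨fun h => by rw [h], fun h => ?_⟩
  have h' := congrArg (fun z => y⁻¹.val * z * y⁻¹.valᵀ) h
  have cancel : ∀ z : Matrix ι ι F, y⁻¹.val * (y.val * z * y.valᵀ) * y⁻¹.valᵀ = z := fun z =>
    calc _ = (y⁻¹.val * y.val) * z * (y.valᵀ * y⁻¹.valᵀ) := by simp only [Matrix.mul_assoc]
      _ = z := by rw [hy, hyT, Matrix.one_mul, Matrix.mul_one]
  simpa only [cancel] using h'

lemma exists_congr_eq_of_linearIndependent (g : Matrix ι ι F) {b : ι → ι → F}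
    (hb : LinearIndependent F b) :
    ∃ y : GL ι F, y.val * g * y.valᵀ =
      Matrix.of fun i j => Matrix.toLinearMap₂' F g (b i) (b j) := by
  obtain ⟨y, hy⟩ : IsUnit (Matrix.of b) := Matrix.linearIndependent_rows_iff_isUnit.1 hb
  refine ⟨y, ?_⟩
  ext i j
  rw [Matrix.of_apply, Matrix.toLinearMap₂'_apply', hy, Matrix.mul_assoc, Matrix.mul_apply']
  rfl

lemma card_lt_card_congruenceStabilizer_diagonal [Fintype F] (h2 : (2 : F) ≠ 0) {a b : F}
    (ha : a ≠ 0) (hb : b ≠ 0) :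
    Fintype.card F < Nat.card (congruenceStabilizer !![a, 0; 0, b]) := by
  classical
  set c := b / a with hc
  have hc0 : c ≠ 0 := div_ne_zero hb ha
  have hca : c * a = b := div_mul_cancel₀ b ha
  let T := {t : F // 1 + c * t ^ 2 ≠ 0}
  let s : Bool → F := fun e => if e then 1 else -1
  have hs : ∀ e, s e ^ 2 = 1 := by intro e; cases e <;> simp [s]
  let α : Option T → F := fun o => o.elim (-1) fun t => (1 - c * t.1 ^ 2) / (1 + c * t.1 ^ 2)
  let β : Option T → F := fun o => o.elim 0 fun t => 2 * t.1 / (1 + c * t.1 ^ 2)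
  have hαβ : ∀ o, α o ^ 2 + c * β o ^ 2 = 1 := by
    rintro (_ | ⟨t, ht⟩)
    · simp [α, β]
    · simp only [α, β, Option.elim_some]
      field_simp
      ring
  have hα : ∀ t : T, (α (some t) + 1) * (1 + c * t.1 ^ 2) = 2 := by
    rintro ⟨t, ht⟩
    simp only [α, Option.elim_some]
    field_simp
    ring
  have hβ : ∀ t : T, β (some t) = t.1 * (α (some t) + 1) := by
    rintro ⟨t, ht⟩
    have h3 := hα ⟨t, ht⟩
    change 2 * t / (1 + c * t ^ 2) = t * (α (some ⟨t, ht⟩) + 1)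
    rw [div_eq_iff ht]
    linear_combination (-t) * h3
  have hα0 : ∀ t : T, α (some t) + 1 ≠ 0 := by
    intro t h0
    have := hα t
    rw [h0, zero_mul] at this
    exact h2 this.symm
  let M : Option T × Bool → Matrix (Fin 2) (Fin 2) F := fun p =>
    !![α p.1, β p.1; -(s p.2 * c * β p.1), s p.2 * α p.1]
  have hdet : ∀ p, (M p).det ≠ 0 := by
    intro p h0
    rw [Matrix.det_fin_two_of] at h0
    have h1 : s p.2 = 0 := by linear_combination h0 - s p.2 * hαβ p.1
    have h3 := hs p.2
    rw [h1] at h3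
    simp at h3
  have hM : ∀ p, M p * !![a, 0; 0, b] * (M p)ᵀ = !![a, 0; 0, b] := by
    intro p
    have h1 := hαβ p.1
    have h3 := hs p.2
    ext i j
    fin_cases i <;> fin_cases j <;> simp [M, Matrix.mul_apply, Fin.sum_univ_two]
    · linear_combination a * h1 - β p.1 ^ 2 * hca
    · linear_combination -(s p.2 * α p.1 * β p.1) * hca
    · linear_combination -(s p.2 * α p.1 * β p.1) * hca
    · linear_combination (s p.2 ^ 2 * c * β p.1 ^ 2) * hca + s p.2 ^ 2 * b * h1 + b * h3
  let f : Option T × Bool → congruenceStabilizer !![a, 0; 0, b] := fun p =>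
    ⟨Matrix.GeneralLinearGroup.mkOfDetNeZero (M p) (hdet p), hM p⟩
  have hf : Function.Injective f := by
    rintro ⟨o, e⟩ ⟨o', e'⟩ h
    have hmat : M (o, e) = M (o', e') := congrArg (fun z => z.val.val) h
    have h00 : α o = α o' := congrFun (congrFun hmat 0) 0
    have h01 : β o = β o' := congrFun (congrFun hmat 0) 1
    have h10 : -(s e * c * β o) = -(s e' * c * β o') := congrFun (congrFun hmat 1) 0
    have h11 : s e * α o = s e' * α o' := congrFun (congrFun hmat 1) 1
    refine Prod.ext ?_ ?_
    · rcases o with _ | t <;> rcases o' with _ | t'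
      · rfl
      · exact absurd (by rw [← h00]; simp [α]) (hα0 t')
      · exact absurd (by rw [h00]; simp [α]) (hα0 t)
      · rw [hβ, hβ, h00] at h01
        exact congrArg some (Subtype.ext (mul_right_cancel₀ (hα0 t') h01))
    · have hse : s e = s e' := by
        rw [← h00] at h11
        rw [← h01] at h10
        linear_combination (s e' - s e) * hαβ o + α o * h11 - β o * h10
      cases e <;> cases e' <;> simp [s] at hse ⊢
      · exact h2 (by linear_combination - hse)
      · exact h2 (by linear_combination hse)
  have hle := Nat.card_le_card_of_injective f hf
  rw [Nat.card_eq_fintype_card, Fintype.card_prod, Fintype.card_option, Fintype.card_bool] at hle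
  have hroots : Fintype.card {t : F // 1 + c * t ^ 2 = 0} ≤ 2 := by
    by_cases hne : Nonempty {t : F // 1 + c * t ^ 2 = 0}
    · obtain ⟨t₀, ht₀⟩ := hne
      rw [Fintype.card_subtype]
      refine (Finset.card_le_card (t := {t₀, -t₀}) fun t ht => ?_).trans Finset.card_le_two
      rw [Finset.mem_filter] at ht
      have : t ^ 2 = t₀ ^ 2 := mul_left_cancel₀ hc0 (by linear_combination ht.2 - ht₀)
      simpa using sq_eq_sq_iff_eq_or_eq_neg.1 this
    · rw [not_nonempty_iff] at hne
      rw [Fintype.card_eq_zero]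
      omega
  have hcompl : Fintype.card T = Fintype.card F - Fintype.card {t : F // 1 + c * t ^ 2 = 0} :=
    Fintype.card_subtype_compl _
  have hq2 : 2 < Fintype.card F := by
    have h1 := Fintype.one_lt_card (α := F)
    have h3 : Fintype.card F ≠ 2 := fun h' => h2 (by
      have := FiniteField.cast_card_eq_zero F
      rw [h'] at this
      exact_mod_cast this)
    omega
  omega

lemma card_lt_card_congruenceStabilizer [Fintype F] (h2 : (2 : F) ≠ 0)
    {g : Matrix (Fin 2) (Fin 2) F} (hg : g 0 1 = g 1 0) (hdet : g.det ≠ 0) :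
    Fintype.card F < Nat.card (congruenceStabilizer g) := by
  suffices ∃ (y : GL (Fin 2) F) (a b : F), y.val * g * y.valᵀ = !![a, 0; 0, b] by
    obtain ⟨y, a, b, hy⟩ := this
    have hab : a * b ≠ 0 := by
      have h1 : (y.val * g * y.valᵀ).det ≠ 0 := by
        rw [Matrix.det_mul, Matrix.det_mul, Matrix.det_transpose]
        have : y.val.det ≠ 0 := ((Matrix.isUnit_iff_isUnit_det _).1 y.isUnit).ne_zero
        exact mul_ne_zero (mul_ne_zero this hdet) this
      rw [hy, Matrix.det_fin_two_of] at h1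
      simpa using h1
    rw [← card_congruenceStabilizer_congr g y, hy]
    exact card_lt_card_congruenceStabilizer_diagonal h2 (left_ne_zero_of_mul hab)
      (right_ne_zero_of_mul hab)
  obtain ⟨a, b, b', d, rfl⟩ : ∃ a b b' d, g = !![a, b; b', d] := ⟨_, _, _, _, g.eta_fin_two⟩
  obtain rfl : b = b' := hg
  rw [Matrix.det_fin_two_of] at hdet
  by_cases ha : a = 0
  · by_cases hd : d = 0
    · refine ⟨Matrix.GeneralLinearGroup.mkOfDetNeZero !![1, 1; 1, -1] ?_, 2 * b, -(2 * b), ?_⟩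
      · rw [Matrix.det_fin_two_of]
        intro h0
        exact h2 (by linear_combination - h0)
      · change !![1, 1; 1, -1] * !![a, b; b, d] * !![1, 1; 1, -1]ᵀ = _
        ext i j
        fin_cases i <;> fin_cases j <;> simp [ha, hd, Matrix.mul_apply, Fin.sum_univ_two] <;> ring
    · refine ⟨Matrix.GeneralLinearGroup.mkOfDetNeZero !![1, -(b / d); 0, 1] (by simp),
        a - b ^ 2 / d, d, ?_⟩
      change !![1, -(b / d); 0, 1] * !![a, b; b, d] * !![1, -(b / d); 0, 1]ᵀ = _
      ext i j
      fin_cases i <;> fin_cases j <;> simp [Matrix.mul_apply, Fin.sum_univ_two] <;>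
        field_simp <;> ring
  · refine ⟨Matrix.GeneralLinearGroup.mkOfDetNeZero !![1, 0; -(b / a), 1] (by simp),
      a, d - b ^ 2 / a, ?_⟩
    change !![1, 0; -(b / a), 1] * !![a, b; b, d] * !![1, 0; -(b / a), 1]ᵀ = _
    ext i j
    fin_cases i <;> fin_cases j <;> simp [Matrix.mul_apply, Fin.sum_univ_two] <;>
      field_simp <;> ring

end Matrices

lemma isAsymmetry_toLinearMap₂' {F : Type} [Field F] {n : ℕ} (g : GL (Fin n) F) {ε : F}
    (hg : (g * tau g).val.charpoly = (Polynomial.X - Polynomial.C ε) ^ n) :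
    IsAsymmetry (Matrix.toLinearMap₂' F g.val) (Matrix.toLin' (g * tau g).valᵀ) ε := by
  have hginv : g.val * g⁻¹.val = 1 := g.mul_inv
  have htau : (g * tau g).valᵀ = g⁻¹.val * g.valᵀ := by
    rw [Units.val_mul, Matrix.transpose_mul]
    rfl
  refine ⟨fun u v => ?_, ⟨n, ?_⟩, fun u hu => ?_⟩
  · rw [Matrix.toLinearMap₂'_apply', Matrix.toLinearMap₂'_apply', Matrix.toLin'_apply, htau,
      Matrix.mulVec_mulVec, ← Matrix.mul_assoc, hginv, Matrix.one_mul, Matrix.mulVec_transpose,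
      Matrix.dotProduct_mulVec, dotProduct_comm]
  · have h1 := Matrix.aeval_self_charpoly (g * tau g).valᵀ
    rw [Matrix.charpoly_transpose, hg] at h1
    have h2 : Matrix.toLin' (g * tau g).valᵀ - ε • (1 : Module.End F (Fin n → F)) =
        Matrix.toLinAlgEquiv' ((g * tau g).valᵀ - algebraMap F _ ε) := by
      rw [map_sub, AlgEquiv.commutes, Algebra.algebraMap_eq_smul_one]
      rfl
    have h3 : ((g * tau g).valᵀ - algebraMap F _ ε) ^ n = 0 := by
      simpa only [map_pow, map_sub, Polynomial.aeval_X, Polynomial.aeval_C] using h1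
    rw [h2, ← map_pow, h3, map_zero]
  · have h1 : u ᵥ* g.val = 0 := by
      funext j
      have := hu (Pi.single j 1)
      rw [Matrix.toLinearMap₂'_apply', Matrix.dotProduct_mulVec, dotProduct_single_one] at this
      exact this
    have h2 := congrArg (· ᵥ* g⁻¹.val) h1
    simpa only [Matrix.vecMul_vecMul, hginv, Matrix.vecMul_one, Matrix.zero_vecMul] using h2

section Main

variable {F : Type} [Field F] [Fintype F]

lemma pow_dvd_card_of_odd_or {n m : ℕ} (hnm : m = n / 2) (g : GL (Fin n) F) {ε : F}
    (hε : ε * ε = 1) (hn : n % 2 = 1 ∨ ε = -1)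
    (hg : (g * tau g).val.charpoly = (Polynomial.X - Polynomial.C ε) ^ n) :
    Fintype.card F ^ m ∣ Nat.card (congruenceStabilizer g.val) := by
  obtain ⟨b, hb, hb'⟩ := exists_isAdapted_of_odd_or hε n _ _ (isAsymmetry_toLinearMap₂' g hg)
    (Module.finrank_fin_fun F) hn
  obtain ⟨y, hy⟩ := exists_congr_eq_of_linearIndependent g.val hb
  rw [← hy] at hb'
  rw [← card_congruenceStabilizer_congr g.val y]
  refine hb'.pow_dvd_card_congruenceStabilizer hε (fun i hi => ?_) Fin.revPerm (fun i => ?_)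
    (fun k : Fin m => (⟨k + 1, by omega⟩, ⟨n - (k + 1), by omega⟩)) (fun k k' h => ?_)
    fun k => ?_
  · rw [hn.resolve_left (by omega)]
    ring
  · rw [Fin.revPerm_apply, Fin.val_rev]
    omega
  · have := congrArg (fun z => (z.1 : ℕ)) h
    simp only at this
    omega
  · simp only [Fin.mk_le_mk]
    omega

lemma pow_dvd_card_of_even {k : ℕ} (hk : k ≠ 0) (g : GL (Fin (2 * k + 2)) F)
    (hg : (g * tau g).val.charpoly = (Polynomial.X - Polynomial.C 1) ^ (2 * k + 2)) :
    Fintype.card F ^ (k + 1) ∣ Nat.card (congruenceStabilizer g.val) := by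
  obtain ⟨b, hb, hb'⟩ := exists_isAdapted_of_even k _ _ (isAsymmetry_toLinearMap₂' g hg)
    (Module.finrank_fin_fun F)
  obtain ⟨y, hy⟩ := exists_congr_eq_of_linearIndependent g.val hb
  rw [← hy] at hb'
  rw [← card_congruenceStabilizer_congr g.val y]
  refine hb'.pow_dvd_card_congruenceStabilizer (one_mul 1) (fun i hi => ?_) Fin.revPerm
    (fun i => ?_)
    (fun l : Fin (k + 1) => if (l : ℕ) = 0 then (⟨k + 1, by omega⟩, ⟨k + 2, by omega⟩)
      else (⟨l, by omega⟩, ⟨2 * k + 1 - (l - 1), by omega⟩)) (fun l l' h => ?_) fun l => ?_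
  · omega
  · rw [Fin.revPerm_apply, Fin.val_rev]
    split_ifs <;> omega
  · have h1 := congrArg (fun z => (z.1 : ℕ)) h
    have hl := l.2
    have hl' := l'.2
    ext
    by_cases h0 : (l : ℕ) = 0 <;> by_cases h0' : (l' : ℕ) = 0 <;>
      simp only [h0, h0', if_true, if_false] at h1 ⊢ <;> omega
  · by_cases hl : (l : ℕ) = 0
    · simp only [hl, if_true, Fin.mk_le_mk]
      split_ifs <;> omega
    · simp only [hl, if_false, Fin.mk_le_mk]
      split_ifs <;> omega

lemma card_lt_card_of_fin_two (h2 : (2 : F) ≠ 0) (g : GL (Fin 2) F)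
    (hg : (g * tau g).val.charpoly = (Polynomial.X - Polynomial.C 1) ^ 2) :
    Fintype.card F < Nat.card (congruenceStabilizer g.val) := by
  obtain ⟨b, hb, hb'⟩ := exists_isAdapted_of_even 0 _ _ (isAsymmetry_toLinearMap₂' g hg)
    (Module.finrank_fin_fun F)
  obtain ⟨y, hy⟩ := exists_congr_eq_of_linearIndependent g.val hb
  rw [← hy] at hb'
  rw [← card_congruenceStabilizer_congr g.val y]
  refine card_lt_card_congruenceStabilizer h2 ?_ ?_
  · rw [← one_mul ((y.val * g.val * y.valᵀ) 1 0)]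
    exact hb'.symm_of_eq 0 1 rfl
  · have hdet : ∀ x : GL (Fin 2) F, x.val.det ≠ 0 := fun x =>
      ((Matrix.isUnit_iff_isUnit_det _).1 x.isUnit).ne_zero
    rw [Matrix.det_mul, Matrix.det_mul, Matrix.det_transpose]
    exact mul_ne_zero (mul_ne_zero (hdet y) (hdet g)) (hdet y)

end Main

theorem stmt18 (q : ℕ) (hq : IsPrimePow q)
    (F : Type) [Field F] [Fintype F] (hF : Fintype.card F = q)
    (n m δ : ℕ) (hδ : δ = 0 ∨ δ = 1) (hnm : n = 2 * m + δ)
    (g : GL (Fin n) F)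
    (hchar : (g * tau g).val.charpoly = (Polynomial.X - 1) ^ n ∨
      (g * tau g).val.charpoly = (Polynomial.X + 1) ^ n) :
    q ^ m ∣ Nat.card {x : GL (Fin n) F // x.val * g.val * x.valᵀ = g.val} ∨
      (q % 2 = 1 ∧ n = 2 ∧
        q ^ m < Nat.card {x : GL (Fin n) F // x.val * g.val * x.valᵀ = g.val}) := by
  change q ^ m ∣ Nat.card (congruenceStabilizer g.val) ∨
    (q % 2 = 1 ∧ n = 2 ∧ q ^ m < Nat.card (congruenceStabilizer g.val))
  subst hF
  by_cases h : n % 2 = 1 ∨ (2 : F) = 0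
  · left
    rcases hchar with hg | hg
    · refine pow_dvd_card_of_odd_or (by omega) g (one_mul (1 : F))
        (h.imp_right fun h2 => ?_) (by simpa using hg)
      linear_combination h2
    · refine pow_dvd_card_of_odd_or (ε := -1) (by omega) g (by ring) (Or.inr rfl)
        (by simpa using hg)
  · rw [not_or] at h
    rcases hchar with hg | hg
    · obtain rfl : n = 2 * m := by omega
      rcases m with _ | _ | k
      · left
        simp
      · right
        refine ⟨FiniteField.odd_card_of_char_ne_two fun hc => h.2 ?_, rfl, ?_⟩
        · have := ringChar.of_eq hc
          exact CharTwo.two_eq_zero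
        · exact (pow_one (Fintype.card F)).trans_lt
            (card_lt_card_of_fin_two h.2 g (by rw [map_one]; exact hg))
      · left
        exact pow_dvd_card_of_even (k := k + 1) (by omega) g (by rw [map_one]; exact hg)
    · left
      exact pow_dvd_card_of_odd_or (ε := -1) (by omega) g (by ring) (Or.inr rfl)
        (by simpa using hg)
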